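/- arXiv:math/0306101 — 2 statements merged into one kernel-verified Lean document; each statement's English description precedes it below -/
import Mathlib

section
/- Let s be a complex number with 0 < Re(s) < 1, let x and R be real numbers with 0 < R < x, and let k be a natural number. Then |G(s+k,x)| / k! ≤ e^{R-x} / ((x-R)·R^k). -/
open MeasureTheory

/-- `G s x = ∫₁^∞ e^{-xy} y^{s-1} dy`. -/
noncomputable def G (s : ℂ) (x : ℝ) : ℂ :=
  ∫ y in Set.Ioi (1 : ℝ), Complex.exp (-(x * y)) * (y : ℂ) ^ (s - 1)

theorem stmt_7 (s : ℂ) (hs0 : 0 < s.re) (hs1 : s.re < 1) (x R : ℝ)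
    (hR : 0 < R) (hRx : R < x) (k : ℕ) :
    ‖G (s + k) x‖ / (Nat.factorial k : ℝ) ≤ Real.exp (R - x) / ((x - R) * R ^ k) := by
  have ha : R - x < 0 := by linarith
  have hk : (0 : ℝ) < (Nat.factorial k : ℝ) := by exact_mod_cast Nat.factorial_pos k
  have hRk : 0 < R ^ k := pow_pos hR k
  have key : ‖G (s + k) x‖ ≤
      ∫ y in Set.Ioi (1 : ℝ), (Nat.factorial k : ℝ) / R ^ k * Real.exp ((R - x) * y) := by
    unfold G
    apply norm_integral_le_of_norm_le
    · exact (integrableOn_exp_mul_Ioi ha 1).const_mul _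
    · refine (ae_restrict_iff' measurableSet_Ioi).2 (Filter.Eventually.of_forall ?_)
      intro y hy
      have hy1 : (1 : ℝ) < y := hy
      have hy0 : 0 < y := by linarith
      have h1 : ‖Complex.exp (-((x : ℂ) * y))‖ = Real.exp (-(x * y)) := by
        rw [Complex.norm_exp]; simp
      have h2 : ‖(y : ℂ) ^ (s + k - 1)‖ ≤ y ^ k := by
        rw [Complex.norm_cpow_eq_rpow_re_of_pos hy0, ← Real.rpow_natCast]
        apply Real.rpow_le_rpow_of_exponent_le hy1.le
        simp
        linarith
      have h3 : y ^ k ≤ (Nat.factorial k : ℝ) / R ^ k * Real.exp (R * y) := by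
        have := Real.pow_div_factorial_le_exp (R * y) (by positivity) k
        rw [div_le_iff₀ hk, mul_pow] at this
        rw [div_mul_eq_mul_div, le_div_iff₀ hRk]
        linarith
      rw [norm_mul, h1]
      calc Real.exp (-(x * y)) * ‖(y : ℂ) ^ (s + k - 1)‖
          ≤ Real.exp (-(x * y)) * ((Nat.factorial k : ℝ) / R ^ k * Real.exp (R * y)) := by
            gcongr
            exact h2.trans h3
        _ = (Nat.factorial k : ℝ) / R ^ k * Real.exp ((R - x) * y) := by
            rw [show (R - x) * y = -(x * y) + R * y by ring, Real.exp_add]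
            ring
  rw [integral_const_mul, integral_exp_mul_Ioi ha] at key
  rw [div_le_iff₀ hk]
  refine key.trans (le_of_eq ?_)
  have h4 : R - x ≠ 0 := ha.ne
  have h5 : x - R ≠ 0 := by intro h; linarith
  rw [mul_one, show R - x = -(x - R) by ring, neg_div_neg_eq]
  field_simp
end

section
/- Let s be a complex number with 0 < Re(s) < 1, let x, R, Δ be real numbers with 0 < Δ < R < x, and let B be a natural number. Then the tail of the Taylor-coefficient series satisfies ∑_{k=B}^∞ (|G(s+k,x)|/k!)·Δ^k ≤ (e^{R-x}/(x-R)) · (Δ/R)^B / (1 - Δ/R). -/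
open MeasureTheory

lemma G_bound (s : ℂ) (hs1 : s.re < 1) (x R : ℝ) (hR : 0 < R) (hRx : R < x) (k : ℕ) :
    ‖G (s + (k : ℂ)) x‖ ≤ (Nat.factorial k : ℝ) / R ^ k * (Real.exp (R - x) / (x - R)) := by
  have hneg : R - x < 0 := by linarith
  have hint : IntegrableOn (fun y : ℝ => Real.exp ((R - x) * y)) (Set.Ioi 1) :=
    integrableOn_exp_mul_Ioi hneg 1
  have hval : ∫ y in Set.Ioi (1 : ℝ), Real.exp ((R - x) * y) = Real.exp (R - x) / (x - R) := by
    rw [integral_exp_mul_Ioi hneg, mul_one, ← neg_sub x R, div_neg, neg_div, neg_neg]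
  rw [← hval, ← integral_const_mul]
  unfold G
  refine norm_integral_le_of_norm_le (hint.const_mul _) ?_
  refine (ae_restrict_iff' measurableSet_Ioi).2 (Filter.Eventually.of_forall ?_)
  intro y hy
  have hy1 : (1 : ℝ) < y := hy
  have hy0 : 0 < y := by linarith
  rw [norm_mul, Complex.norm_exp, Complex.norm_cpow_eq_rpow_re_of_pos hy0]
  have h1 : (-((x : ℂ) * (y : ℂ))).re = -(x * y) := by simp
  have h2 : y ^ (s + (k : ℂ) - 1).re ≤ y ^ k := by
    rw [← Real.rpow_natCast]
    apply Real.rpow_le_rpow_of_exponent_le hy1.le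
    simp
    linarith
  have h3 : (R * y) ^ k / (Nat.factorial k : ℝ) ≤ Real.exp (R * y) :=
    Real.pow_div_factorial_le_exp _ (by positivity) k
  have hf : (0 : ℝ) < Nat.factorial k := by exact_mod_cast Nat.factorial_pos k
  have h4 : y ^ k ≤ (Nat.factorial k : ℝ) / R ^ k * Real.exp (R * y) := by
    rw [div_le_iff₀ hf, mul_pow] at h3
    rw [div_mul_eq_mul_div, le_div_iff₀ (by positivity)]
    linarith
  rw [h1]
  calc Real.exp (-(x * y)) * y ^ (s + (k : ℂ) - 1).re
      ≤ Real.exp (-(x * y)) * ((Nat.factorial k : ℝ) / R ^ k * Real.exp (R * y)) := by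
        gcongr
        exact h2.trans h4
    _ = (Nat.factorial k : ℝ) / R ^ k * Real.exp ((R - x) * y) := by
        rw [show (R - x) * y = -(x * y) + R * y by ring, Real.exp_add]
        ring

theorem stmt_8 (s : ℂ) (hs0 : 0 < s.re) (hs1 : s.re < 1) (x R Δ : ℝ)
    (hΔ : 0 < Δ) (hΔR : Δ < R) (hRx : R < x) (B : ℕ) :
    ∑' k : ℕ, ‖G (s + ((B + k : ℕ) : ℂ)) x‖ / (Nat.factorial (B + k) : ℝ) * Δ ^ (B + k) ≤
      Real.exp (R - x) / (x - R) * (Δ / R) ^ B / (1 - Δ / R) := by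
  have hR : 0 < R := hΔ.trans hΔR
  have hq0 : 0 ≤ Δ / R := by positivity
  have hq1 : Δ / R < 1 := (div_lt_one hR).2 hΔR
  have hsum : HasSum (fun k : ℕ => Real.exp (R - x) / (x - R) * (Δ / R) ^ B * (Δ / R) ^ k)
      (Real.exp (R - x) / (x - R) * (Δ / R) ^ B * (1 - Δ / R)⁻¹) :=
    (hasSum_geometric_of_lt_one hq0 hq1).mul_left _
  have hle : ∀ k : ℕ,
      ‖G (s + ((B + k : ℕ) : ℂ)) x‖ / (Nat.factorial (B + k) : ℝ) * Δ ^ (B + k) ≤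
        Real.exp (R - x) / (x - R) * (Δ / R) ^ B * (Δ / R) ^ k := by
    intro k
    have hf : (0 : ℝ) < Nat.factorial (B + k) := by exact_mod_cast Nat.factorial_pos _
    have h := G_bound s hs1 x R hR hRx (B + k)
    calc _ ≤ ((Nat.factorial (B + k) : ℝ) / R ^ (B + k) * (Real.exp (R - x) / (x - R)))
          / (Nat.factorial (B + k) : ℝ) * Δ ^ (B + k) := by gcongr
      _ = Real.exp (R - x) / (x - R) * (Δ / R) ^ (B + k) := by
        rw [div_pow]
        field_simp
      _ = _ := by rw [pow_add]; ring
  have hs : Summable (fun k : ℕ =>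
      ‖G (s + ((B + k : ℕ) : ℂ)) x‖ / (Nat.factorial (B + k) : ℝ) * Δ ^ (B + k)) :=
    Summable.of_nonneg_of_le (fun k => by positivity) hle hsum.summable
  rw [div_eq_mul_inv _ (1 - Δ / R), ← hsum.tsum_eq]
  exact hs.tsum_le_tsum hle hsum.summable
end
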